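/- Let β : ℝ → ℝ be continuous, B(t) = ∫₀ᵗ β(τ) dτ, and let Θ_uu, Θ_un be real numbers with Θ_un ≠ 0; set λ = |Θ_un| and y(t) = λ·B(t) + arctan(Θ_uu/λ). Let I ⊆ ℝ be an interval containing 0 with |y(t)| < π/2 for all t ∈ I. Define the symmetric 3×3 matrix family Θ(t) (indices u,l,n) with Θ(t)_uu = λ·tan(y(t)), Θ(t)_nn = −λ·tan(y(t)), Θ(t)_un = Θ(t)_nu = Θ_un, and all other entries zero; and define U(t) by U(t)_uu = 1 − Θ_uu·B(t), U(t)_un = −Θ_un·B(t), U(t)_ll = 1, U(t)_nu = Θ_uu/Θ_un − (λ/Θ_un)·(1 − Θ_uu·B(t))·tan(y(t)), U(t)_nn = 1 + λ·B(t)·tan(y(t)), and all other entries zero. Then U is the unique differentiable family of 3×3 real matrices on I satisfying U'(t) + β(t)·Θ(t)·U(t) = 0 with U(0) = Id. -/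

import Mathlib

open Real Matrix

/-- A function with zero derivative within an order-connected set of reals is constant on it. -/
lemma eq_of_hasDerivWithinAt_zero {I : Set ℝ} (hI : I.OrdConnected) {f : ℝ → ℝ}
    (hf : ∀ t ∈ I, HasDerivWithinAt f 0 I t) {a b : ℝ} (ha : a ∈ I) (hb : b ∈ I) :
    f b = f a := by
  have h := hI.convex.norm_image_sub_le_of_norm_hasDerivWithin_le (C := 0) hf
    (fun _ _ => norm_zero.le) ha hb
  rw [zero_mul, norm_le_zero_iff] at h
  exact sub_eq_zero.1 h

/-- The Wronskian of two solutions of a trace-free planar linear system has zero derivative. -/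
lemma hasDerivWithinAt_wronskian {I : Set ℝ} {a c p q : ℝ → ℝ} {t β m k : ℝ}
    (ha : HasDerivWithinAt a (-(β * (m * a t + k * c t))) I t)
    (hc : HasDerivWithinAt c (-(β * (k * a t - m * c t))) I t)
    (hp : HasDerivWithinAt p (-(β * (m * p t + k * q t))) I t)
    (hq : HasDerivWithinAt q (-(β * (k * p t - m * q t))) I t) :
    HasDerivWithinAt (fun s => a s * q s - c s * p s) 0 I t := by
  refine ((ha.mul hq).sub (hc.mul hp)).congr_deriv ?_
  ring

/-- The three rows of the equation `V' + β Θ V = 0`, for `Θ` symmetric and trace-free with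
vanishing middle row. -/
lemma hasDerivWithinAt_rows {I : Set ℝ} {V : ℝ → Matrix (Fin 3) (Fin 3) ℝ} {t β m k : ℝ} (j : Fin 3)
    (h : ∀ i, HasDerivWithinAt (fun s => V s i j)
      (-(β * (!![m, 0, k; 0, 0, 0; k, 0, -m] * V t) i j)) I t) :
    HasDerivWithinAt (fun s => V s 0 j) (-(β * (m * V t 0 j + k * V t 2 j))) I t ∧
    HasDerivWithinAt (fun s => V s 1 j) 0 I t ∧
    HasDerivWithinAt (fun s => V s 2 j) (-(β * (k * V t 0 j - m * V t 2 j))) I t := by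
  refine ⟨(h 0).congr_deriv ?_, (h 1).congr_deriv ?_, (h 2).congr_deriv ?_⟩ <;>
    simp [Matrix.mul_apply, Fin.sum_univ_three, sub_eq_add_neg]

/-- Explicit solution of the coframe evolution equation `U' + β Θ U = 0` of the
left-invariant parallel spinor flow in the case `Θ_ul = 0`, `Θ_un ≠ 0`;
`3×3` matrices are indexed by `Fin 3` with `0 = u`, `1 = l`, `2 = n`. -/
theorem stmt_8
    (β B : ℝ → ℝ) (hβ : Continuous β)
    (hB : ∀ t, B t = ∫ τ in (0:ℝ)..t, β τ)
    (Θuu Θun : ℝ) (hΘun : Θun ≠ 0)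
    (lam : ℝ) (hlam : lam = |Θun|)
    (y : ℝ → ℝ) (hy : ∀ t, y t = lam * B t + arctan (Θuu / lam))
    (I : Set ℝ) (hI : I.OrdConnected) (h0 : (0:ℝ) ∈ I)
    (hsmall : ∀ t ∈ I, |y t| < π / 2)
    (Θm U : ℝ → Matrix (Fin 3) (Fin 3) ℝ)
    (hΘm : ∀ t, Θm t =
      !![lam * tan (y t), 0, Θun;
         0,               0, 0;
         Θun,             0, -(lam * tan (y t))])
    (hU : ∀ t, U t =
      !![1 - Θuu * B t,                                            0, -(Θun * B t);
         0,                                                        1, 0;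
         Θuu / Θun - (lam / Θun) * (1 - Θuu * B t) * tan (y t),    0, 1 + lam * B t * tan (y t)]) :
    -- U is differentiable and solves U' + β Θ U = 0 on I with U(0) = Id
    ((∀ t ∈ I, ∀ i j, HasDerivWithinAt (fun s => U s i j)
        (-(β t * (Θm t * U t) i j)) I t) ∧ U 0 = 1) ∧
    -- and it is the unique such family
    ∀ V : ℝ → Matrix (Fin 3) (Fin 3) ℝ,
      (∀ t ∈ I, ∀ i j, HasDerivWithinAt (fun s => V s i j)
        (-(β t * (Θm t * V t) i j)) I t) → V 0 = 1 →
      ∀ t ∈ I, V t = U t := by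
  have hlam0 : lam ≠ 0 := by rw [hlam]; exact abs_ne_zero.2 hΘun
  have hsq : lam ^ 2 = Θun ^ 2 := by rw [hlam, sq_abs]
  have hBd : ∀ t, HasDerivAt B (β t) t := fun t => by
    rw [funext hB]
    exact intervalIntegral.integral_hasDerivAt_right (hβ.intervalIntegrable _ _)
      (hβ.stronglyMeasurableAtFilter _ _) hβ.continuousAt
  have hB0 : B 0 = 0 := by simp [hB]
  have hT0 : tan (y 0) = Θuu / lam := by rw [hy, hB0, mul_zero, zero_add, tan_arctan]
  have hTd : ∀ t ∈ I,
      HasDerivAt (fun s => tan (y s)) ((1 + tan (y t) ^ 2) * (lam * β t)) t := fun t ht => by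
    have hcos : cos (y t) ≠ 0 := (cos_pos_of_mem_Ioo (abs_lt.1 (hsmall t ht))).ne'
    have hyd : HasDerivAt y (lam * β t) t := by
      rw [funext hy]
      exact ((hBd t).const_mul lam).add_const _
    refine ((hasDerivAt_tan hcos).comp t hyd).congr_deriv ?_
    rw [← inv_one_add_tan_sq hcos, one_div, inv_inv]
  have hU0 : U 0 = 1 := by
    rw [hU, hB0, hT0]
    ext i j
    fin_cases i <;> fin_cases j <;> simp
    field_simp
    ring
  have hsol : ∀ t ∈ I, ∀ i j, HasDerivWithinAt (fun s => U s i j)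
      (-(β t * (Θm t * U t) i j)) I t := by
    intro t ht i j
    apply HasDerivAt.hasDerivWithinAt
    have hP : HasDerivAt (fun s => 1 - Θuu * B s) (-(Θuu * β t)) t :=
      ((hBd t).const_mul Θuu).const_sub 1
    have hR : HasDerivAt (fun s => -(Θun * B s)) (-(Θun * β t)) t :=
      ((hBd t).const_mul Θun).neg
    have hQ := ((hP.const_mul (lam / Θun)).mul (hTd t ht)).const_sub (Θuu / Θun)
    have hS := ((hBd t).const_mul lam).mul (hTd t ht)
    simp only [hU, hΘm]
    fin_cases i <;> fin_cases j <;> simp [Matrix.mul_apply, Fin.sum_univ_three]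
    · refine hP.congr_deriv ?_
      field_simp
      ring
    · exact hasDerivAt_const _ _
    · refine hR.congr_deriv ?_
      ring
    · exact hasDerivAt_const _ _
    · exact hasDerivAt_const _ _
    · exact hasDerivAt_const _ _
    · refine hQ.congr_deriv ?_
      field_simp
      linear_combination (-β t * (1 - Θuu * B t)) * hsq
    · exact hasDerivAt_const _ _
    · refine hS.congr_deriv ?_
      linear_combination (β t * B t) * hsq
  refine ⟨⟨hsol, hU0⟩, fun V hV hV0 t ht => ?_⟩
  have hdet : U t 0 0 * U t 2 2 - U t 0 2 * U t 2 0 = 1 := by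
    simp only [hU]
    simp
    field_simp
    ring
  have rows : ∀ W : ℝ → Matrix (Fin 3) (Fin 3) ℝ,
      (∀ s ∈ I, ∀ i j, HasDerivWithinAt (fun r => W r i j) (-(β s * (Θm s * W s) i j)) I s) →
      ∀ j, ∀ s ∈ I, _ := fun W hW j s hs =>
    hasDerivWithinAt_rows j fun i => by simpa only [hΘm] using hW s hs i j
  have wronskian : ∀ j k, V t 0 j * U t 2 k - V t 2 j * U t 0 k =
      U t 0 j * U t 2 k - U t 2 j * U t 0 k := fun j k => by
    have h : ∀ W : ℝ → Matrix (Fin 3) (Fin 3) ℝ,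
        (∀ s ∈ I, ∀ i j, HasDerivWithinAt (fun r => W r i j) (-(β s * (Θm s * W s) i j)) I s) →
        W t 0 j * U t 2 k - W t 2 j * U t 0 k = W 0 0 j * U 0 2 k - W 0 2 j * U 0 0 k :=
      fun W hW => eq_of_hasDerivWithinAt_zero hI
        (f := fun s => W s 0 j * U s 2 k - W s 2 j * U s 0 k)
        (fun s hs => hasDerivWithinAt_wronskian (rows W hW j s hs).1 (rows W hW j s hs).2.2
          (rows U hsol k s hs).1 (rows U hsol k s hs).2.2) h0 ht
    rw [h V hV, h U hsol, hV0, hU0]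
  have middle : ∀ W : ℝ → Matrix (Fin 3) (Fin 3) ℝ,
      (∀ s ∈ I, ∀ i j, HasDerivWithinAt (fun r => W r i j) (-(β s * (Θm s * W s) i j)) I s) →
      ∀ j, W t 1 j = W 0 1 j := fun W hW j =>
    eq_of_hasDerivWithinAt_zero hI (f := fun s => W s 1 j)
      (fun s hs => (rows W hW j s hs).2.1) h0 ht
  ext i j
  have h1 := wronskian j 0
  have h2 := wronskian j 2
  fin_cases i
  · change V t 0 j = U t 0 j
    linear_combination U t 0 0 * h2 - U t 0 2 * h1 - (V t 0 j - U t 0 j) * hdet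
  · change V t 1 j = U t 1 j
    rw [middle V hV, middle U hsol, hV0, hU0]
  · change V t 2 j = U t 2 j
    linear_combination U t 2 0 * h2 - U t 2 2 * h1 - (V t 2 j - U t 2 j) * hdet
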